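/- For every d>0 and δ>0 there exists E>0 such that for all r>d, all h>0, and all z∈ℂ with Re z<−E one has |∫₀^∞ t·e^{zt} p_h(r,t) dt| ≤ ((1+δ)/(4π)) · (π²·r²/(4·(−Re z)³))^{1/4} · exp(−√(−Re z)·r), and the same bound holds with p_h replaced by the free kernel p_0. (This is an upper bound for the z-derivative of the Green function of the Landau Hamiltonian at distance r.) -/

import Mathlib

open MeasureTheory Real Set

/-- Modulus of the Landau heat kernel at distance `r`. -/
noncomputable def landauHeatKernel (h r t : ℝ) : ℝ :=
  h / (4 * π * Real.sinh (h * t)) *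
    Real.exp (-(h * r ^ 2 * (Real.cosh (h * t) / Real.sinh (h * t))) / 4)

/-- Free heat kernel on `ℝ²` at distance `r`. -/
noncomputable def freeHeatKernel (r t : ℝ) : ℝ :=
  1 / (4 * π * t) * Real.exp (-(r ^ 2) / (4 * t))

/-- The Landau heat kernel is dominated by the free heat kernel. -/
lemma landauHeatKernel_le_freeHeatKernel {h r t : ℝ} (hh : 0 < h) (ht : 0 < t) :
    landauHeatKernel h r t ≤ freeHeatKernel r t := by
  have hx : 0 < h * t := mul_pos hh ht
  have hs : h * t ≤ sinh (h * t) := self_le_sinh_iff.2 hx.le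
  have hs0 : 0 < sinh (h * t) := hx.trans_le hs
  have hc : sinh (h * t) ≤ h * t * cosh (h * t) := by
    have hmono : MonotoneOn (fun x : ℝ => x * cosh x - sinh x) (Ici 0) := by
      refine monotoneOn_of_hasDerivWithinAt_nonneg (f' := fun x => x * sinh x) (convex_Ici 0)
        (by fun_prop) (fun x _ => ?_) (fun x hx => ?_)
      · refine HasDerivAt.hasDerivWithinAt ?_
        refine (((hasDerivAt_id x).mul (hasDerivAt_cosh x)).sub (hasDerivAt_sinh x)).congr_deriv ?_
        simp
      · rw [interior_Ici] at hx
        exact mul_nonneg (le_of_lt hx) (sinh_nonneg_iff.2 (le_of_lt hx))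
    have := hmono (mem_Ici.2 le_rfl) (mem_Ici.2 hx.le) hx.le
    simp at this
    linarith
  unfold landauHeatKernel freeHeatKernel
  have h1 : h / (4 * π * sinh (h * t)) ≤ 1 / (4 * π * t) := by
    rw [div_le_div_iff₀ (by positivity) (by positivity)]
    nlinarith [mul_le_mul_of_nonneg_left hs (by positivity : 0 ≤ 4 * π)]
  have h2 : 1 / t ≤ h * (cosh (h * t) / sinh (h * t)) := by
    rw [← mul_div_assoc, div_le_div_iff₀ ht hs0]
    linarith
  have h3 : -(h * r ^ 2 * (cosh (h * t) / sinh (h * t))) / 4 ≤ -(r ^ 2) / (4 * t) := by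
    have h4 : -(r ^ 2) / (4 * t) = -(r ^ 2 * (1 / t)) / 4 := by field_simp
    rw [h4]
    nlinarith [mul_le_mul_of_nonneg_left h2 (sq_nonneg r)]
  exact mul_le_mul h1 (exp_le_exp.2 h3) (exp_pos _).le (by positivity)

lemma landauHeatKernel_nonneg {h r t : ℝ} (hh : 0 < h) (ht : 0 < t) :
    0 ≤ landauHeatKernel h r t := by
  have : 0 < sinh (h * t) := sinh_pos_iff.2 (mul_pos hh ht)
  unfold landauHeatKernel
  positivity

lemma freeHeatKernel_nonneg {r t : ℝ} (ht : 0 < t) : 0 ≤ freeHeatKernel r t := by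
  unfold freeHeatKernel
  positivity

lemma integral_quadratic_mul_gaussian (b c e : ℝ) :
    Integrable (fun y : ℝ => (b * y ^ 2 + c * y + e) * exp (-y ^ 2)) ∧
      ∫ y : ℝ, (b * y ^ 2 + c * y + e) * exp (-y ^ 2) = (b / 2 + e) * √π := by
  have i0 : Integrable (fun y : ℝ => exp (-y ^ 2)) := by
    simpa using integrable_exp_neg_mul_sq (b := 1) one_pos
  have i1 : Integrable (fun y : ℝ => y * exp (-y ^ 2)) := by
    simpa using integrable_mul_exp_neg_mul_sq (b := 1) one_pos
  have i2 : Integrable (fun y : ℝ => y ^ 2 * exp (-y ^ 2)) := by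
    simpa using integrable_rpow_mul_exp_neg_mul_sq (b := 1) one_pos (s := 2) (by norm_num)
  have hg : ∫ y : ℝ, exp (-y ^ 2) = √π := by simpa using integral_gaussian 1
  have hi : Integrable (fun y : ℝ => (b * y ^ 2 + c * y + e) * exp (-y ^ 2)) := by
    refine (((i2.const_mul b).add (i1.const_mul c)).add (i0.const_mul e)).congr
      (Filter.Eventually.of_forall fun y => ?_)
    simp only [Pi.add_apply]
    ring
  refine ⟨hi, ?_⟩
  have hF : Integrable (fun y : ℝ => (-(b / 2) * y - c / 2) * exp (-y ^ 2)) := by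
    refine ((i1.const_mul (-(b / 2))).add (i0.const_mul (-(c / 2)))).congr
      (Filter.Eventually.of_forall fun y => ?_)
    simp only [Pi.add_apply]
    ring
  have hd := integral_eq_zero_of_hasDerivAt_of_integrable
    (f' := fun y : ℝ => (b * y ^ 2 + c * y + e) * exp (-y ^ 2) - (b / 2 + e) * exp (-y ^ 2))
    (fun y => by
      have h1 : HasDerivAt (fun y : ℝ => -(b / 2) * y - c / 2) (-(b / 2)) y := by
        simpa using ((hasDerivAt_id y).const_mul (-(b / 2))).sub_const (c / 2)
      have h2 : HasDerivAt (fun y : ℝ => exp (-y ^ 2)) (exp (-y ^ 2) * (-(2 * y))) y := by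
        simpa using ((hasDerivAt_pow 2 y).neg).exp
      exact (h1.mul h2).congr_deriv (by ring))
    (hi.sub (i0.const_mul _)) hF
  rw [integral_sub hi (i0.const_mul _), integral_const_mul, hg] at hd
  linarith

lemma integrableOn_exp_neg_mul_sub_div {a r : ℝ} (ha : 0 < a) :
    IntegrableOn (fun t : ℝ => exp (-(a * t) - r ^ 2 / (4 * t))) (Ioi 0) := by
  refine Integrable.mono' (exp_neg_integrableOn_Ioi 0 ha) (by fun_prop) ?_
  filter_upwards [ae_restrict_mem measurableSet_Ioi] with t ht
  have ht : 0 < t := ht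
  rw [norm_eq_abs, abs_exp, exp_le_exp]
  have : 0 ≤ r ^ 2 / (4 * t) := by positivity
  linarith

/-- The substitution `√(a t) - r / (2 √t) = y` bounds this Bessel-type integral by a Gaussian
one. -/
lemma integral_exp_neg_mul_sub_div_le {a r : ℝ} (ha : 0 < a) (hr : 0 < r) :
    ∫ t in Ioi (0 : ℝ), exp (-(a * t) - r ^ 2 / (4 * t)) ≤
      (1 + 1 / (2 * (√a * r))) * (√(2 * π * (√a * r)) / (2 * a)) * exp (-√a * r) := by
  obtain ⟨s, hs⟩ : ∃ s, s = √a * r := ⟨_, rfl⟩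
  have hs0 : 0 < s := by rw [hs]; positivity
  have hs2 : s ^ 2 = a * r ^ 2 := by rw [hs, mul_pow, sq_sqrt ha.le]
  rw [neg_mul, ← hs]
  let w : ℝ → ℝ := fun y => √(y ^ 2 + 2 * s)
  let g : ℝ → ℝ := fun y => (y + w y) ^ 2 / (4 * a)
  let g' : ℝ → ℝ := fun y => (2 * y + (2 * y ^ 2 + 2 * s) / w y) / (2 * a)
  have hw0 (y : ℝ) : 0 < w y := sqrt_pos.2 (by positivity)
  have hw2 (y : ℝ) : w y ^ 2 = y ^ 2 + 2 * s := sq_sqrt (by positivity)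
  have hu (y : ℝ) : 0 < y + w y := by
    have : |y| < w y := by
      rw [← sqrt_sq_eq_abs]
      exact sqrt_lt_sqrt (sq_nonneg y) (by linarith)
    linarith [neg_abs_le y]
  have hwd (y : ℝ) : HasDerivAt w (y / w y) y := by
    have h1 : HasDerivAt (fun y : ℝ => y ^ 2 + 2 * s) (2 * y) y := by
      simpa using (hasDerivAt_pow 2 y).add_const (2 * s)
    refine (h1.sqrt (by positivity)).congr_deriv ?_
    change 2 * y / (2 * w y) = _
    rw [mul_div_mul_left _ _ two_ne_zero]
  have hgd (y : ℝ) : HasDerivAt g (g' y) y := by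
    refine ((((hasDerivAt_id y).add (hwd y)).pow 2).div_const (4 * a)).congr_deriv ?_
    have := (hw0 y).ne'
    simp only [g', Pi.add_apply, id]
    field_simp
    push_cast
    linear_combination (2 : ℝ) * hw2 y
  have hgpos (y : ℝ) : 0 < g' y := by
    have h1 : g' y = (y + w y) ^ 2 / (2 * a * w y) := by
      have := (hw0 y).ne'
      simp only [g']
      field_simp
      linear_combination -hw2 y
    have := hw0 y
    have := hu y
    rw [h1]
    positivity
  have hmono : StrictMono g := strictMono_of_hasDerivAt_pos hgd hgpos
  have himg : g '' univ = Ioi 0 := by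
    ext t
    simp only [image_univ, mem_range, mem_Ioi]
    constructor
    · rintro ⟨y, rfl⟩
      have := hu y
      positivity
    · intro ht
      have hv : 0 < √(a * t) := sqrt_pos.2 (by positivity)
      have hv2 : √(a * t) ^ 2 = a * t := sq_sqrt (by positivity)
      set v := √(a * t)
      refine ⟨v - s / (2 * v), ?_⟩
      have hwv : w (v - s / (2 * v)) = v + s / (2 * v) := by
        simp only [w]
        rw [← sqrt_sq (by positivity : 0 ≤ v + s / (2 * v))]
        congr 1
        field_simp
        ring
      simp only [g]
      rw [hwv]
      field_simp
      linear_combination 16 * v ^ 2 * hv2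
  have hexp (y : ℝ) : -(a * g y) - r ^ 2 / (4 * g y) = -y ^ 2 - s := by
    have hu' := (hu y).ne'
    have h1 : r ^ 2 / (4 * g y) = ((w y - y) / 2) ^ 2 := by
      have h2 : s = (w y - y) * (y + w y) / 2 := by linear_combination -hw2 y / 2
      have h3 : r ^ 2 / (4 * g y) = (s / (y + w y)) ^ 2 := by
        rw [div_pow, hs2]
        simp only [g]
        field_simp
      rw [h3]
      congr 1
      rw [div_eq_div_iff hu' two_ne_zero]
      linear_combination 2 * h2
    rw [h1]
    simp only [g]
    field_simp
    linear_combination -8 * hw2 y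
  rw [← himg, integral_image_eq_integral_abs_deriv_smul MeasurableSet.univ
    (fun y _ => (hgd y).hasDerivWithinAt) hmono.injective.injOn, setIntegral_univ]
  simp only [hexp, smul_eq_mul, abs_of_pos (hgpos _)]
  set q := √(2 * s) with hq
  have hq0 : 0 < q := sqrt_pos.2 (by positivity)
  have hq2 : q ^ 2 = 2 * s := sq_sqrt (by positivity)
  obtain ⟨hi, hval⟩ := integral_quadratic_mul_gaussian (2 / q) 2 (2 * s / q)
  have hle : ∫ y, g' y * exp (-y ^ 2 - s) ≤
      ∫ y, exp (-s) / (2 * a) * ((2 / q * y ^ 2 + 2 * y + 2 * s / q) * exp (-y ^ 2)) := by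
    refine integral_mono_of_nonneg (Filter.Eventually.of_forall fun y => ?_) (hi.const_mul _)
      (Filter.Eventually.of_forall fun y => ?_)
    · exact mul_nonneg (hgpos y).le (exp_pos _).le
    · have hqw : q ≤ w y := sqrt_le_sqrt (by nlinarith [sq_nonneg y])
      have h1 : (2 * y ^ 2 + 2 * s) / w y ≤ (2 * y ^ 2 + 2 * s) / q :=
        div_le_div_of_nonneg_left (by positivity) hq0 hqw
      have h2 : g' y ≤ (2 / q * y ^ 2 + 2 * y + 2 * s / q) / (2 * a) := by
        have h3 : 2 / q * y ^ 2 + 2 * y + 2 * s / q = 2 * y + (2 * y ^ 2 + 2 * s) / q := by ring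
        rw [h3]
        simp only [g']
        gcongr
      have h4 : exp (-y ^ 2 - s) = exp (-s) * exp (-y ^ 2) := by
        rw [← exp_add]
        ring_nf
      simp only [h4]
      calc g' y * (exp (-s) * exp (-y ^ 2)) ≤
            (2 / q * y ^ 2 + 2 * y + 2 * s / q) / (2 * a) * (exp (-s) * exp (-y ^ 2)) :=
            mul_le_mul_of_nonneg_right h2 (by positivity)
        _ = _ := by ring
  refine hle.trans (le_of_eq ?_)
  rw [integral_const_mul, hval, show 2 * π * s = 2 * s * π by ring,
    sqrt_mul (by positivity : 0 ≤ 2 * s), ← hq]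
  have h5 : (2 / q / 2 + 2 * s / q) = (1 + 1 / (2 * s)) * q := by
    rw [← hq2]
    field_simp
    ring
  rw [h5]
  ring

lemma norm_integral_mul_exp_mul_le {a r : ℝ} {z : ℂ} {k : ℝ → ℝ} (ha : 0 < a) (hz : a = -z.re)
    (hk0 : ∀ t, 0 < t → 0 ≤ k t) (hk : ∀ t, 0 < t → k t ≤ freeHeatKernel r t) :
    ‖∫ t in Ioi (0 : ℝ), (t : ℂ) * Complex.exp (z * t) * (k t : ℂ)‖ ≤
      1 / (4 * π) * ∫ t in Ioi (0 : ℝ), exp (-(a * t) - r ^ 2 / (4 * t)) := by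
  rw [← integral_const_mul]
  refine norm_integral_le_of_norm_le ((integrableOn_exp_neg_mul_sub_div ha).const_mul _) ?_
  filter_upwards [ae_restrict_mem measurableSet_Ioi] with t ht
  have ht : 0 < t := ht
  rw [norm_mul, norm_mul, Complex.norm_exp, Complex.norm_real, Complex.norm_real,
    norm_of_nonneg ht.le, norm_of_nonneg (hk0 t ht), Complex.re_mul_ofReal]
  calc t * exp (z.re * t) * k t ≤ t * exp (z.re * t) * freeHeatKernel r t := by
        gcongr
        exact hk t ht
    _ = _ := by
        have h1 : exp (-(a * t) - r ^ 2 / (4 * t)) =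
            exp (z.re * t) * exp (-(r ^ 2) / (4 * t)) := by
          rw [← exp_add, hz]
          ring_nf
        rw [h1, freeHeatKernel]
        field_simp

lemma rpow_quarter_eq {a r : ℝ} (ha : 0 < a) (hr : 0 < r) :
    (π ^ 2 * r ^ 2 / (4 * a ^ 3)) ^ ((1 : ℝ) / 4) = √(2 * π * (√a * r)) / (2 * a) := by
  have h1 : π ^ 2 * r ^ 2 / (4 * a ^ 3) = (√(2 * π * (√a * r)) / (2 * a)) ^ 4 := by
    have h2 : √(2 * π * (√a * r)) ^ 4 = 4 * π ^ 2 * (a * r ^ 2) := by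
      calc √(2 * π * (√a * r)) ^ 4 = (√(2 * π * (√a * r)) ^ 2) ^ 2 := by ring
        _ = 4 * π ^ 2 * (√a ^ 2 * r ^ 2) := by rw [sq_sqrt (by positivity)]; ring
        _ = _ := by rw [sq_sqrt ha.le]
    rw [div_pow, h2]
    field_simp
    norm_num
  have h3 := pow_rpow_inv_natCast (x := √(2 * π * (√a * r)) / (2 * a)) (by positivity)
    (n := 4) (by norm_num)
  rw [h1]
  simpa using h3

/-- Upper bound for the `z`-derivative of the Green function of the Landau Hamiltonian
(and of the free Laplacian): for all `d,δ>0` there is `E>0` such that for `r>d`, `h>0`,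
`Re z<−E`,
`|∫₀^∞ t e^{zt} p_h(r,t) dt| ≤ ((1+δ)/(4π)) (π² r²/(4(−Re z)³))^{1/4} e^{−√(−Re z) r}`,
and the same bound with `p_h` replaced by `p_0`. -/
theorem landau_green_derivative_upper_bound (d δ : ℝ) (hd : 0 < d) (hδ : 0 < δ) :
    ∃ E > 0, ∀ (r h : ℝ) (z : ℂ), d < r → 0 < h → z.re < -E →
      (‖∫ t in Ioi (0 : ℝ), (t : ℂ) * Complex.exp (z * t) * ((landauHeatKernel h r t : ℝ) : ℂ)‖ ≤
        ((1 + δ) / (4 * π)) * (π ^ 2 * r ^ 2 / (4 * (-z.re) ^ 3)) ^ ((1 : ℝ) / 4) *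
          Real.exp (-Real.sqrt (-z.re) * r)) ∧
      (‖∫ t in Ioi (0 : ℝ), (t : ℂ) * Complex.exp (z * t) * ((freeHeatKernel r t : ℝ) : ℂ)‖ ≤
        ((1 + δ) / (4 * π)) * (π ^ 2 * r ^ 2 / (4 * (-z.re) ^ 3)) ^ ((1 : ℝ) / 4) *
          Real.exp (-Real.sqrt (-z.re) * r)) := by
  refine ⟨(1 / (2 * δ * d)) ^ 2, by positivity, fun r h z hr hh hz => ?_⟩
  obtain ⟨a, ha⟩ : ∃ a, a = -z.re := ⟨_, rfl⟩
  have haE : (1 / (2 * δ * d)) ^ 2 < a := by linarith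
  have ha0 : 0 < a := lt_of_le_of_lt (sq_nonneg _) haE
  have hr0 : 0 < r := hd.trans hr
  rw [← ha, rpow_quarter_eq ha0 hr0]
  have hδs : 1 / (2 * (√a * r)) ≤ δ := by
    have h1 : 1 / (2 * δ * d) ≤ √a := le_sqrt_of_sq_le haE.le
    have h2 : 1 / (2 * δ * d) * d ≤ √a * r := mul_le_mul h1 hr.le hd.le (sqrt_nonneg a)
    have h3 : 1 / (2 * δ * d) * d = 1 / (2 * δ) := by field_simp
    rw [h3, div_le_iff₀ (by positivity)] at h2
    rw [div_le_iff₀ (by positivity)]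
    linarith
  have key (k : ℝ → ℝ) (hk0 : ∀ t, 0 < t → 0 ≤ k t)
      (hk : ∀ t, 0 < t → k t ≤ freeHeatKernel r t) :
      ‖∫ t in Ioi (0 : ℝ), (t : ℂ) * Complex.exp (z * t) * (k t : ℂ)‖ ≤
        (1 + δ) / (4 * π) * (√(2 * π * (√a * r)) / (2 * a)) * exp (-√a * r) := by
    calc _ ≤ 1 / (4 * π) * ∫ t in Ioi (0 : ℝ), exp (-(a * t) - r ^ 2 / (4 * t)) :=
          norm_integral_mul_exp_mul_le ha0 ha hk0 hk
      _ ≤ 1 / (4 * π) *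
          ((1 + δ) * (√(2 * π * (√a * r)) / (2 * a)) * exp (-√a * r)) := by
          refine mul_le_mul_of_nonneg_left
            ((integral_exp_neg_mul_sub_div_le ha0 hr0).trans ?_) (by positivity)
          gcongr
      _ = _ := by ring
  exact ⟨key _ (fun t => landauHeatKernel_nonneg hh)
      (fun t => landauHeatKernel_le_freeHeatKernel hh),
    key _ (fun t => freeHeatKernel_nonneg) (fun t _ => le_rfl)⟩
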